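/- Let I ⊆ K[x_0, x_1, x_2] be the radical ideal of n ≥ 5 distinct points lying on a smooth conic C in P^2, where n is odd. Then I^{(2r)} ⊆ M^r I^r for every integer r ≥ 1. -/

import Mathlib

open MvPolynomial

noncomputable section

/-- The ideal generated by all homogeneous forms vanishing at the point with
coordinate vector `p`. -/
def homVanishingIdeal {K σ : Type*} [Field K] (p : σ → K) : Ideal (MvPolynomial σ K) :=
  Ideal.span {F : MvPolynomial σ K | (∃ d, F.IsHomogeneous d) ∧ MvPolynomial.eval p F = 0}

/-- The `m`-th symbolic power of the radical ideal of the finite set of points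
with coordinate vectors `P i`: the intersection of the `m`-th powers of the
ideals of the individual points. -/
def symbPow {K σ ι : Type*} [Field K] (P : ι → σ → K) (m : ℕ) : Ideal (MvPolynomial σ K) :=
  ⨅ i, homVanishingIdeal (P i) ^ m

/-- The irrelevant maximal ideal `M = (x_0, …, x_N)`. -/
def irrel (K σ : Type*) [Field K] : Ideal (MvPolynomial σ K) :=
  Ideal.span (Set.range (MvPolynomial.X : σ → MvPolynomial σ K))

/-- The coordinate vectors `P i` are nonzero and represent pairwise distinct
points of projective space (no two are proportional). -/
def ProjectivelyDistinct {K σ ι : Type*} [Field K] (P : ι → σ → K) : Prop :=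
  (∀ i, P i ≠ 0) ∧ Pairwise fun i j => ∀ c : K, P i ≠ c • P j

/-- `α(J)`: the least degree of a nonzero homogeneous element of `J`. -/
def idealAlpha {K σ : Type*} [Field K] (J : Ideal (MvPolynomial σ K)) : ℕ :=
  sInf {d : ℕ | ∃ F ∈ J, F ≠ 0 ∧ MvPolynomial.IsHomogeneous F d}

/-- The `K`-algebra map `K[x] → K[x][T]` fixing a linear form `λ` with `λ(p) = 1` and scaling by
`T` the linear forms vanishing at `p`. -/
def pointScaling {K σ : Type*} [Field K] (p : σ → K) (j : σ) :
    MvPolynomial σ K →ₐ[K] Polynomial (MvPolynomial σ K) :=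
  MvPolynomial.aeval fun i =>
    Polynomial.C (MvPolynomial.C (p i) * (MvPolynomial.C (p j)⁻¹ * MvPolynomial.X j)) +
      Polynomial.C (MvPolynomial.X i -
        MvPolynomial.C (p i) * (MvPolynomial.C (p j)⁻¹ * MvPolynomial.X j)) * Polynomial.X

section PointIdeal

variable {K σ : Type*} [Field K]

lemma aeval_C_mul_of_isHomogeneous {F : MvPolynomial σ K} {d : ℕ} (hF : F.IsHomogeneous d)
    (p : σ → K) (l : MvPolynomial σ K) :
    aeval (fun i => C (p i) * l) F = C (eval p F) * l ^ d := by
  conv_lhs => rw [F.as_sum]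
  rw [eval_eq, map_sum, map_sum, Finset.sum_mul]
  refine Finset.sum_congr rfl fun m hm => ?_
  have hd : m.degree = d := by
    have := hF (mem_support_iff.mp hm)
    rwa [Finsupp.degree_eq_weight_one]
  rw [aeval_monomial, ← hd, Finsupp.degree_apply, ← Finset.prod_pow_eq_pow_sum, Finsupp.prod]
  simp only [mul_pow, Finset.prod_mul_distrib, map_mul, map_prod, map_pow,
    MvPolynomial.algebraMap_eq]
  ring

lemma aeval_sub_aeval_mem {A : Type*} [CommRing A] [Algebra K A] (J : Ideal A) {f g : σ → A}
    (h : ∀ i, f i - g i ∈ J) (F : MvPolynomial σ K) : aeval f F - aeval g F ∈ J := by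
  rw [← Ideal.Quotient.eq]
  have : (Ideal.Quotient.mkₐ K J).comp (aeval f) = (Ideal.Quotient.mkₐ K J).comp (aeval g) := by
    ext i
    simpa [Ideal.Quotient.eq] using h i
  exact DFunLike.congr_fun this F

lemma mem_homVanishingIdeal_of_isHomogeneous {p : σ → K} {F : MvPolynomial σ K} {d : ℕ}
    (hF : F.IsHomogeneous d) (h : eval p F = 0) : F ∈ homVanishingIdeal p :=
  Ideal.subset_span ⟨⟨d, hF⟩, h⟩

lemma eval_eq_zero_of_mem_homVanishingIdeal {p : σ → K} {F : MvPolynomial σ K}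
    (hF : F ∈ homVanishingIdeal p) : eval p F = 0 := by
  have : homVanishingIdeal p ≤ RingHom.ker (eval p) :=
    Ideal.span_le.mpr fun G hG => hG.2
  exact this hF

lemma X_sub_mem_homVanishingIdeal {p : σ → K} {j : σ} (hj : p j ≠ 0) (i : σ) :
    X i - C (p i) * (C (p j)⁻¹ * X j) ∈ homVanishingIdeal p := by
  refine mem_homVanishingIdeal_of_isHomogeneous (d := 1) ?_ ?_
  · have h : (C (p i) * (C (p j)⁻¹ * X j) : MvPolynomial σ K).IsHomogeneous 1 :=
      ((isHomogeneous_X K j).C_mul _).C_mul _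
    exact (isHomogeneous_X K i).sub h
  · simp [hj]

lemma pointScaling_mem_reesAlgebra {p : σ → K} {j : σ} (hj : p j ≠ 0) (F : MvPolynomial σ K) :
    pointScaling p j F ∈ reesAlgebra (homVanishingIdeal p) := by
  induction F using MvPolynomial.induction_on with
  | C a =>
    rw [← MvPolynomial.algebraMap_eq, AlgHom.commutes]
    exact (reesAlgebra (homVanishingIdeal p)).algebraMap_mem (algebraMap K _ a)
  | add F G hF hG => rw [map_add]; exact add_mem hF hG
  | mul_X F i hF =>
    rw [map_mul]
    refine mul_mem hF ?_
    rw [pointScaling, aeval_X]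
    refine add_mem ((reesAlgebra (homVanishingIdeal p)).algebraMap_mem _) ?_
    rw [← pow_one Polynomial.X, Polynomial.C_mul_X_pow_eq_monomial]
    exact reesAlgebra.monomial_mem.mpr (by simpa using X_sub_mem_homVanishingIdeal hj i)

lemma eval_one_pointScaling (p : σ → K) (j : σ) (F : MvPolynomial σ K) :
    (pointScaling p j F).eval 1 = F := by
  have : ((Polynomial.aeval (1 : MvPolynomial σ K)).restrictScalars K).comp (pointScaling p j)
      = AlgHom.id K _ := by
    ext i
    simp [pointScaling]
  simpa using DFunLike.congr_fun this F

lemma eval_zero_pointScaling (p : σ → K) (j : σ) (F : MvPolynomial σ K) :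
    (pointScaling p j F).eval 0 = aeval (fun i => C (p i) * (C (p j)⁻¹ * X j)) F := by
  have : ((Polynomial.aeval (0 : MvPolynomial σ K)).restrictScalars K).comp (pointScaling p j)
      = aeval (fun i => C (p i) * (C (p j)⁻¹ * X j)) := by
    ext i
    simp [pointScaling]
  simpa using DFunLike.congr_fun this F

lemma mem_homVanishingIdeal_pow_iff {p : σ → K} {j : σ} (hj : p j ≠ 0) (m : ℕ)
    {F : MvPolynomial σ K} :
    F ∈ homVanishingIdeal p ^ m ↔ Polynomial.X ^ m ∣ pointScaling p j F := by
  constructor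
  · intro hF
    have hle : homVanishingIdeal p ≤
        (Ideal.span {(Polynomial.X : Polynomial (MvPolynomial σ K))}).comap (pointScaling p j) := by
      refine Ideal.span_le.mpr ?_
      rintro G ⟨⟨d, hG⟩, hG0⟩
      rw [SetLike.mem_coe, Ideal.mem_comap, Ideal.mem_span_singleton, Polynomial.X_dvd_iff,
        Polynomial.coeff_zero_eq_eval_zero, eval_zero_pointScaling,
        aeval_C_mul_of_isHomogeneous hG, hG0, C_0, zero_mul]
    have := Ideal.le_comap_pow _ m (Ideal.pow_right_mono hle m hF)
    rwa [Ideal.mem_comap, Ideal.span_singleton_pow, Ideal.mem_span_singleton] at this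
  · intro h
    rw [← eval_one_pointScaling p j F, Polynomial.eval_eq_sum]
    refine Ideal.sum_mem _ fun k _ => ?_
    simp only [one_pow, mul_one]
    by_cases hk : k < m
    · rw [Polynomial.X_pow_dvd_iff.mp h k hk]
      exact zero_mem _
    · exact Ideal.pow_le_pow_right (not_lt.mp hk)
        ((mem_reesAlgebra_iff _ _).mp (pointScaling_mem_reesAlgebra hj F) k)

lemma homVanishingIdeal_isPrime {p : σ → K} (hp : p ≠ 0) : (homVanishingIdeal p).IsPrime := by
  obtain ⟨j, hj⟩ := Function.ne_iff.mp hp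
  have key (F) : F ∈ homVanishingIdeal p ↔ Polynomial.X ∣ pointScaling p j F := by
    simpa using mem_homVanishingIdeal_pow_iff hj 1 (F := F)
  refine ⟨fun h => ?_, fun {F G} h => ?_⟩
  · have := eval_eq_zero_of_mem_homVanishingIdeal ((Ideal.eq_top_iff_one _).mp h)
    simp at this
  · rw [key, map_mul] at h
    rw [key, key]
    exact Polynomial.prime_X.dvd_or_dvd h

lemma mem_homVanishingIdeal_pow_of_mul_mem {p : σ → K} (hp : p ≠ 0) {Q F : MvPolynomial σ K}
    (hQ : Q ∉ homVanishingIdeal p ^ 2) {m : ℕ} (h : Q * F ∈ homVanishingIdeal p ^ (m + 1)) :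
    F ∈ homVanishingIdeal p ^ m := by
  obtain ⟨j, hj⟩ := Function.ne_iff.mp hp
  rw [mem_homVanishingIdeal_pow_iff hj] at hQ h ⊢
  rw [map_mul] at h
  induction m with
  | zero => simp
  | succ m ih =>
    obtain ⟨G, hG⟩ := ih (dvd_trans (pow_dvd_pow _ (by omega)) h)
    rw [hG, show (Polynomial.X : Polynomial (MvPolynomial σ K)) ^ (m + 1 + 1) =
      Polynomial.X ^ m * Polynomial.X ^ 2 by ring, mul_left_comm] at h
    have h2 := (mul_dvd_mul_iff_left (pow_ne_zero m Polynomial.X_ne_zero)).mp h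
    rw [hG, pow_succ]
    refine mul_dvd_mul_left _ ?_
    by_contra hn
    exact hQ (Polynomial.prime_X.pow_dvd_of_dvd_mul_right 2 hn h2)

lemma pderiv_mem_of_mem_sq {J : Ideal (MvPolynomial σ K)} {Q : MvPolynomial σ K}
    (hQ : Q ∈ J ^ 2) (i : σ) : pderiv i Q ∈ J := by
  rw [pow_two] at hQ
  refine Submodule.mul_induction_on hQ (fun a ha b hb => ?_) fun a b ha hb => ?_
  · rw [Derivation.leibniz]
    exact add_mem (J.mul_mem_right _ ha) (J.mul_mem_right _ hb)
  · rw [map_add]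
    exact add_mem ha hb

end PointIdeal

section CoordForm

variable {K : Type*} [Field K]

/-- The `k`-th coordinate with respect to the basis `b`, as a linear form. -/
def coordForm (b : Module.Basis (Fin 3) K (Fin 3 → K)) (k : Fin 3) : MvPolynomial (Fin 3) K :=
  ∑ j, C (b.coord k (Pi.single j 1)) * X j

variable (b : Module.Basis (Fin 3) K (Fin 3 → K))

lemma isHomogeneous_coordForm (k : Fin 3) : (coordForm b k).IsHomogeneous 1 :=
  IsHomogeneous.sum _ _ _ fun j _ => (isHomogeneous_X K j).C_mul _

lemma eval_coordForm (k : Fin 3) (v : Fin 3 → K) : eval v (coordForm b k) = b.coord k v := by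
  conv_rhs => rw [pi_eq_sum_univ' v, map_sum]
  simp only [coordForm, map_sum, map_mul, eval_C, eval_X, map_smul, smul_eq_mul, mul_comm]

lemma eval_basis_coordForm (k l : Fin 3) :
    eval (b l) (coordForm b k) = if l = k then 1 else 0 := by
  rw [eval_coordForm, Module.Basis.coord_apply, Module.Basis.repr_self, Finsupp.single_apply]

lemma X_eq_sum_coordForm (i : Fin 3) :
    (X i : MvPolynomial (Fin 3) K) = ∑ k, C (b k i) * coordForm b k := by
  simp only [coordForm, Finset.mul_sum, ← mul_assoc, ← C_mul]
  rw [Finset.sum_comm]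
  simp only [← Finset.sum_mul, ← map_sum]
  have h (j : Fin 3) : ∑ k, b k i * b.coord k (Pi.single j 1) = (Pi.single j 1 : Fin 3 → K) i := by
    conv_rhs => rw [← b.sum_repr (Pi.single j 1)]
    simp [Finset.sum_apply, mul_comm]
  simp only [h, Pi.single_apply]
  simp

lemma coordForm_ne_zero (k : Fin 3) : coordForm b k ≠ 0 := by
  intro h
  have := eval_basis_coordForm b k k
  simp [h] at this

lemma exists_basis_of_not_smul {u v : Fin 3 → K} (hu : u ≠ 0) (h : ∀ c : K, v ≠ c • u) :
    ∃ b : Module.Basis (Fin 3) K (Fin 3 → K), b 0 = u ∧ b 1 = v := by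
  have hli : LinearIndependent K ![u, v] :=
    (LinearIndependent.pair_iff' hu).mpr fun a ha => h a ha.symm
  obtain ⟨w, hw⟩ := exists_linearIndependent_snoc_of_lt_finrank hli (by simp)
  refine ⟨basisOfLinearIndependentOfCardEqFinrank hw (by simp), ?_, ?_⟩ <;>
    rw [coe_basisOfLinearIndependentOfCardEqFinrank] <;> rfl

lemma mem_irrel_of_isHomogeneous {F : MvPolynomial (Fin 3) K} {d : ℕ} (hF : F.IsHomogeneous d)
    (hd : d ≠ 0) : F ∈ irrel K (Fin 3) := by
  rw [irrel, ← Set.image_univ, mem_ideal_span_X_image]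
  intro m hm
  by_contra! h
  have hm0 : m = 0 := Finsupp.ext fun i => h i (Set.mem_univ i)
  have := hF (mem_support_iff.mp hm)
  simp [hm0] at this
  exact hd this.symm

lemma sub_aeval_mem_span_coordForm {S : Ideal (MvPolynomial (Fin 3) K)} {s : Finset (Fin 3)}
    (hS : ∀ k ∉ s, coordForm b k ∈ S) (F : MvPolynomial (Fin 3) K) :
    F - aeval (fun i => ∑ k ∈ s, C (b k i) * coordForm b k) F ∈ S := by
  have h := aeval_sub_aeval_mem S (f := X)
    (g := fun i => ∑ k ∈ s, C (b k i) * coordForm b k) (fun i => ?_) F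
  · simpa using h
  · rw [X_eq_sum_coordForm b i, ← Finset.sum_sdiff (Finset.subset_univ s), add_sub_cancel_right]
    exact Ideal.sum_mem _ fun k hk => S.mul_mem_left _ (hS k (Finset.mem_sdiff.mp hk).2)

lemma homVanishingIdeal_basis (k : Fin 3) :
    homVanishingIdeal (b k) = Ideal.span {F | ∃ l ≠ k, F = coordForm b l} := by
  apply le_antisymm
  · refine Ideal.span_le.mpr ?_
    rintro F ⟨⟨d, hF⟩, hF0⟩
    have h := sub_aeval_mem_span_coordForm b (s := {k})
      (S := Ideal.span {F | ∃ l ≠ k, F = coordForm b l})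
      (fun l hl => Ideal.subset_span ⟨l, by simpa using hl, rfl⟩) F
    simp only [Finset.sum_singleton] at h
    rwa [aeval_C_mul_of_isHomogeneous hF, hF0, C_0, zero_mul, sub_zero] at h
  · refine Ideal.span_le.mpr ?_
    rintro _ ⟨l, hl, rfl⟩
    exact mem_homVanishingIdeal_of_isHomogeneous (isHomogeneous_coordForm b l)
      (by rw [eval_basis_coordForm, if_neg hl.symm])

end CoordForm

section Conic

variable {K : Type*} [Field K]

lemma exists_coeff_of_isHomogeneous_two {σ : Type*} [Fintype σ] {Q : MvPolynomial σ K}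
    (hQ : Q.IsHomogeneous 2) :
    ∃ c : σ → σ → K, Q = ∑ i, ∑ j, C (c i j) * (X i * X j) := by
  classical
  rw [Q.as_sum]
  refine Finset.sum_induction _ (fun F => ∃ c : σ → σ → K, F = ∑ i, ∑ j, C (c i j) * (X i * X j))
    ?_ ⟨0, by simp⟩ ?_
  · rintro _ _ ⟨c, rfl⟩ ⟨c', rfl⟩
    exact ⟨c + c', by simp [add_mul, Finset.sum_add_distrib]⟩
  · intro m hm
    have hd : Finsupp.degree m = 2 := by
      have := hQ (mem_support_iff.mp hm)
      rwa [Finsupp.degree_eq_weight_one]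
    obtain ⟨i, j, rfl⟩ : ∃ i j, m = Finsupp.single i 1 + Finsupp.single j 1 := by
      have hcard : (Finsupp.toMultiset m).card = 2 := (Finsupp.card_toMultiset m).trans hd
      obtain ⟨i, j, hij⟩ := Multiset.card_eq_two.mp hcard
      refine ⟨i, j, ?_⟩
      rw [← Finsupp.toMultiset_toFinsupp m, hij, Multiset.insert_eq_cons,
        ← Multiset.singleton_add, map_add, Multiset.toFinsupp_singleton,
        Multiset.toFinsupp_singleton]
    refine ⟨fun i' j' => if i' = i ∧ j' = j then coeff (Finsupp.single i 1 + Finsupp.single j 1) Q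
      else 0, ?_⟩
    rw [Finset.sum_eq_single i, Finset.sum_eq_single j]
    · simp [X, monomial_mul, C_mul_monomial]
    · intro j' _ hj'
      simp [hj']
    · simp
    · intro i' _ hi'
      simp [hi']
    · simp

/-- The symmetric bilinear form polar to the quadratic form `∑ c i j x_i x_j`. -/
def polarForm (c : Fin 3 → Fin 3 → K) (u v : Fin 3 → K) : K :=
  ∑ i, ∑ j, c i j * (u i * v j + u j * v i)

lemma eval_pderiv_quadratic (c : Fin 3 → Fin 3 → K) (p : Fin 3 → K) (k : Fin 3) :
    eval p (pderiv k (∑ i, ∑ j, C (c i j) * (X i * X j))) = polarForm c p (Pi.single k 1) := by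
  simp [polarForm, Derivation.leibniz, pderiv_X, Pi.single_apply, apply_ite (eval p)]

lemma polarForm_sum_smul_right (c : Fin 3 → Fin 3 → K) (p : Fin 3 → K) (a : Fin 3 → K)
    (w : Fin 3 → Fin 3 → K) :
    polarForm c p (∑ k, a k • w k) = ∑ k, a k * polarForm c p (w k) := by
  simp only [polarForm, Fin.sum_univ_three, Pi.add_apply, Pi.smul_apply, smul_eq_mul]
  ring

lemma polarForm_comb_left (c : Fin 3 → Fin 3 → K) (s t : K) (u v w : Fin 3 → K) :
    polarForm c (s • u + t • v) w = s * polarForm c u w + t * polarForm c v w := by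
  simp only [polarForm, Fin.sum_univ_three, Pi.add_apply, Pi.smul_apply, smul_eq_mul]
  ring

lemma polarForm_comm (c : Fin 3 → Fin 3 → K) (u v : Fin 3 → K) :
    polarForm c u v = polarForm c v u := by
  simp only [polarForm, Fin.sum_univ_three]
  ring

lemma polarForm_self (c : Fin 3 → Fin 3 → K) (u : Fin 3 → K) :
    polarForm c u u = 2 * eval u (∑ i, ∑ j, C (c i j) * (X i * X j)) := by
  simp only [polarForm, Fin.sum_univ_three, map_add, map_mul, eval_C, eval_X]
  ring

lemma aeval_quadratic_comb (c : Fin 3 → Fin 3 → K) (u v : Fin 3 → K) {A : Type*} [CommRing A]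
    [Algebra K A] (s t : A) :
    aeval (fun i => algebraMap K A (u i) * s + algebraMap K A (v i) * t)
        (∑ i, ∑ j, C (c i j) * (X i * X j)) =
      algebraMap K A (eval u (∑ i, ∑ j, C (c i j) * (X i * X j))) * s ^ 2 +
      algebraMap K A (polarForm c u v) * (s * t) +
      algebraMap K A (eval v (∑ i, ∑ j, C (c i j) * (X i * X j))) * t ^ 2 := by
  simp only [polarForm, Fin.sum_univ_three, map_add, map_mul, eval_C, eval_X, aeval_X, aeval_C]
  ring

lemma eval_quadratic_comb (c : Fin 3 → Fin 3 → K) (u v : Fin 3 → K) (s t : K) :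
    eval (s • u + t • v) (∑ i, ∑ j, C (c i j) * (X i * X j)) =
      eval u (∑ i, ∑ j, C (c i j) * (X i * X j)) * s ^ 2 + polarForm c u v * (s * t) +
      eval v (∑ i, ∑ j, C (c i j) * (X i * X j)) * t ^ 2 := by
  simp only [polarForm, Fin.sum_univ_three, map_add, map_mul, eval_C, eval_X, Pi.add_apply,
    Pi.smul_apply, smul_eq_mul]
  ring

/-- A smooth conic contains no line: the polar form pairs two of its points nontrivially. -/
lemma polarForm_ne_zero (c : Fin 3 → Fin 3 → K) {Q : MvPolynomial (Fin 3) K}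
    (hQ : Q = ∑ i, ∑ j, C (c i j) * (X i * X j))
    (hsm : ∀ p : Fin 3 → K, p ≠ 0 → eval p Q = 0 → ∃ i, eval p (pderiv i Q) ≠ 0)
    (b : Module.Basis (Fin 3) K (Fin 3 → K)) (h0 : eval (b 0) Q = 0) (h1 : eval (b 1) Q = 0) :
    polarForm c (b 0) (b 1) ≠ 0 := by
  subst hQ
  intro hβ
  obtain ⟨s, t, hp, hst⟩ : ∃ s t : K, s • b 0 + t • b 1 ≠ 0 ∧
      s * polarForm c (b 0) (b 2) + t * polarForm c (b 1) (b 2) = 0 := by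
    by_cases h : polarForm c (b 0) (b 2) = 0
    · exact ⟨1, 0, by simpa using b.ne_zero 0, by simp [h]⟩
    · refine ⟨polarForm c (b 1) (b 2), -polarForm c (b 0) (b 2), fun h' => h ?_, by ring⟩
      have := congrArg (b.coord 1) h'
      simpa [Finsupp.single_apply] using this
  obtain ⟨k, hk⟩ := hsm _ hp (by rw [eval_quadratic_comb, h0, h1, hβ]; ring)
  rw [eval_pderiv_quadratic, ← b.sum_repr (Pi.single k 1), polarForm_sum_smul_right] at hk
  refine hk (Finset.sum_eq_zero fun l _ => ?_)
  rw [polarForm_comb_left]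
  fin_cases l
  · simp [polarForm_self, h0, polarForm_comm c (b 1), hβ]
  · simp [polarForm_self, h1, hβ]
  · simp [hst]

/-- The line `L` through the points `u` and `v` of the conic `Q` meets the conic exactly in these
two points, transversally. -/
structure IsSecant (Q : MvPolynomial (Fin 3) K) (u v : Fin 3 → K) (L : MvPolynomial (Fin 3) K) :
    Prop where
  mem_irrel : L ∈ irrel K (Fin 3)
  mem_left : L ∈ homVanishingIdeal u
  mem_right : L ∈ homVanishingIdeal v
  notMem : ∀ w : Fin 3 → K, eval w Q = 0 → (∀ c : K, w ≠ c • u) → (∀ c : K, w ≠ c • v) →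
    L ∉ homVanishingIdeal w
  dvd_of_dvd_mul : ∀ F, Q ∣ L * F → Q ∣ F
  inf_le : homVanishingIdeal u ⊓ homVanishingIdeal v ≤ Ideal.span {L, Q}
  left_local : ∃ G ∉ homVanishingIdeal u, ∀ F ∈ homVanishingIdeal u, G * F ∈ Ideal.span {L, Q}
  right_local : ∃ G ∉ homVanishingIdeal v, ∀ F ∈ homVanishingIdeal v, G * F ∈ Ideal.span {L, Q}

lemma exists_isSecant {Q : MvPolynomial (Fin 3) K} (hQdeg : Q.IsHomogeneous 2)
    (hsm : ∀ p : Fin 3 → K, p ≠ 0 → eval p Q = 0 → ∃ i, eval p (pderiv i Q) ≠ 0)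
    {u v : Fin 3 → K} (hu : u ≠ 0) (huv : ∀ a : K, v ≠ a • u)
    (hQu : eval u Q = 0) (hQv : eval v Q = 0) : ∃ L, IsSecant Q u v L := by
  obtain ⟨c, hc⟩ := exists_coeff_of_isHomogeneous_two hQdeg
  obtain ⟨b, rfl, rfl⟩ := exists_basis_of_not_smul hu huv
  have hβ := polarForm_ne_zero c hc hsm b hQu hQv
  set β := polarForm c (b 0) (b 1) with hβdef
  set l₀ := coordForm b 0 with hl₀
  set l₁ := coordForm b 1 with hl₁
  set L := coordForm b 2 with hL
  let π : MvPolynomial (Fin 3) K →ₐ[K] MvPolynomial (Fin 3) K :=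
    aeval fun i => C (b 0 i) * l₀ + C (b 1 i) * l₁
  have hπ (F) : L ∣ F - π F := by
    rw [← Ideal.mem_span_singleton]
    have := sub_aeval_mem_span_coordForm b (S := Ideal.span {L}) (s := {0, 1})
      (fun k hk => ?_) F
    · simpa only [Finset.sum_pair (zero_ne_one : (0 : Fin 3) ≠ 1)] using this
    · have : k = 2 := by fin_cases k <;> simp_all
      rw [this]
      exact Ideal.mem_span_singleton_self _
  have hπL : π L = 0 := by
    have h (k) : π (coordForm b k) =
        C (eval (b 0) (coordForm b k)) * l₀ + C (eval (b 1) (coordForm b k)) * l₁ := by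
      simp only [π, coordForm, Fin.sum_univ_three, map_add, map_mul, aeval_X, algHom_C,
        MvPolynomial.algebraMap_eq, eval_C, eval_X]
      ring
    rw [hL, h, eval_basis_coordForm, eval_basis_coordForm]
    simp
  have hπQ : π Q = C β * (l₀ * l₁) := by
    have := aeval_quadratic_comb c (b 0) (b 1) l₀ l₁
    rw [← hc, hQu, hQv] at this
    simpa [π] using this
  have hπQ0 : π Q ≠ 0 := by
    rw [hπQ]
    exact mul_ne_zero (by simpa using hβ) (mul_ne_zero (coordForm_ne_zero b 0)
      (coordForm_ne_zero b 1))
  have hL0 : L ≠ 0 := coordForm_ne_zero b 2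
  have hprod : l₀ * l₁ ∈ Ideal.span {L, Q} := by
    obtain ⟨W, hW⟩ := hπ Q
    refine Ideal.mem_span_pair.mpr ⟨-C β⁻¹ * W, C β⁻¹, ?_⟩
    have : C β⁻¹ * C β = (1 : MvPolynomial (Fin 3) K) := by
      rw [← C_mul, inv_mul_cancel₀ hβ, C_1]
    rw [hπQ] at hW
    linear_combination C β⁻¹ * hW + (l₀ * l₁) * this
  have hLmem : L ∈ Ideal.span {L, Q} := Ideal.subset_span (by simp)
  have hI0 : homVanishingIdeal (b 0) = Ideal.span {l₁, L} := by
    rw [homVanishingIdeal_basis]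
    congr 1
    ext F
    simp [Fin.exists_fin_succ, hl₁, hL]
  have hI1 : homVanishingIdeal (b 1) = Ideal.span {l₀, L} := by
    rw [homVanishingIdeal_basis]
    congr 1
    ext F
    simp [Fin.exists_fin_succ, hl₀, hL]
  have hl₀0 : l₀ ∉ homVanishingIdeal (b 0) := fun h => by
    simpa [hl₀, eval_basis_coordForm] using eval_eq_zero_of_mem_homVanishingIdeal h
  have hl₁1 : l₁ ∉ homVanishingIdeal (b 1) := fun h => by
    simpa [hl₁, eval_basis_coordForm] using eval_eq_zero_of_mem_homVanishingIdeal h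
  refine ⟨L, ?_, ?_, ?_, ?_, ?_, ?_, ⟨l₀, hl₀0, ?_⟩, ⟨l₁, hl₁1, ?_⟩⟩
  · exact mem_irrel_of_isHomogeneous (isHomogeneous_coordForm b 2) one_ne_zero
  · rw [hI0]; exact Ideal.subset_span (by simp)
  · rw [hI1]; exact Ideal.subset_span (by simp)
  · intro w hw h0 h1 hLw
    have hLw := eval_eq_zero_of_mem_homVanishingIdeal hLw
    rw [hL, eval_coordForm] at hLw
    have hsum := b.sum_repr w
    rw [Fin.sum_univ_three, ← b.coord_apply 2, hLw, zero_smul, add_zero] at hsum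
    rw [← hsum, hc, eval_quadratic_comb, ← hc, hQu, hQv] at hw
    have : b.repr w 0 = 0 ∨ b.repr w 1 = 0 := by
      simpa [← hβdef, hβ] using hw
    rcases this with h | h
    · exact h1 _ (by rw [← hsum, h, zero_smul, zero_add])
    · exact h0 _ (by rw [← hsum, h, zero_smul, add_zero])
  · rintro F ⟨W, hW⟩
    have hπW : π W = 0 := by
      have := congrArg π hW
      rw [map_mul, map_mul, hπL, zero_mul, eq_comm, mul_eq_zero] at this
      exact this.resolve_left hπQ0
    obtain ⟨W', hW'⟩ := hπ W
    rw [hπW, sub_zero] at hW'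
    refine ⟨W', mul_left_cancel₀ hL0 ?_⟩
    rw [hW, hW']
    ring
  · rintro F ⟨hF0, hF1⟩
    rw [SetLike.mem_coe, hI0, Ideal.mem_span_pair] at hF0
    obtain ⟨x, y, rfl⟩ := hF0
    have hx : x ∈ homVanishingIdeal (b 1) := by
      have hLx : L ∈ homVanishingIdeal (b 1) := by
        rw [hI1]; exact Ideal.subset_span (by simp)
      have := (Ideal.add_mem_iff_left _ (Ideal.mul_mem_left _ y hLx)).mp hF1
      exact ((homVanishingIdeal_isPrime (b.ne_zero 1)).mem_or_mem this).resolve_right hl₁1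
    rw [hI1, Ideal.mem_span_pair] at hx
    obtain ⟨x', y', rfl⟩ := hx
    have : (x' * l₀ + y' * L) * l₁ + y * L = x' * (l₀ * l₁) + (y' * l₁ + y) * L := by ring
    rw [this]
    exact add_mem (Ideal.mul_mem_left _ _ hprod) (Ideal.mul_mem_left _ _ hLmem)
  · intro F hF
    rw [hI0, Ideal.mem_span_pair] at hF
    obtain ⟨x, y, rfl⟩ := hF
    rw [show l₀ * (x * l₁ + y * L) = x * (l₀ * l₁) + (l₀ * y) * L by ring]
    exact add_mem (Ideal.mul_mem_left _ _ hprod) (Ideal.mul_mem_left _ _ hLmem)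
  · intro F hF
    rw [hI1, Ideal.mem_span_pair] at hF
    obtain ⟨x, y, rfl⟩ := hF
    rw [show l₁ * (x * l₀ + y * L) = x * (l₀ * l₁) + (l₁ * y) * L by ring]
    exact add_mem (Ideal.mul_mem_left _ _ hprod) (Ideal.mul_mem_left _ _ hLmem)

end Conic

section VanishingOrder

variable {K : Type*} [Field K] {Q : MvPolynomial (Fin 3) K} {u v : Fin 3 → K}
  {L : MvPolynomial (Fin 3) K}

lemma IsSecant.symm (h : IsSecant Q u v L) : IsSecant Q v u L where
  mem_irrel := h.mem_irrel
  mem_left := h.mem_right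
  mem_right := h.mem_left
  notMem w hw hv hu := h.notMem w hw hu hv
  dvd_of_dvd_mul := h.dvd_of_dvd_mul
  inf_le := inf_comm (homVanishingIdeal u) _ ▸ h.inf_le
  left_local := h.right_local
  right_local := h.left_local

/-- The restriction of `F` to the curve `Q = 0` vanishes to order at least `m` at `p`. -/
def VanishesOnCurve (Q : MvPolynomial (Fin 3) K) (p : Fin 3 → K) (m : ℕ)
    (F : MvPolynomial (Fin 3) K) : Prop :=
  ∃ G ∉ homVanishingIdeal p, G * F ∈ homVanishingIdeal p ^ m ⊔ Ideal.span {Q}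

lemma VanishesOnCurve.of_mem_pow {F : MvPolynomial (Fin 3) K} {m : ℕ}
    (h : F ∈ homVanishingIdeal u ^ m) : VanishesOnCurve Q u m F :=
  ⟨1, fun h1 => by simpa using eval_eq_zero_of_mem_homVanishingIdeal h1,
    by simpa using Ideal.mem_sup_left h⟩

lemma VanishesOnCurve.of_add_mul {F W : MvPolynomial (Fin 3) K} {m : ℕ}
    (h : VanishesOnCurve Q u m (F + Q * W)) : VanishesOnCurve Q u m F := by
  obtain ⟨G, hG, hGF⟩ := h
  refine ⟨G, hG, ?_⟩
  rw [mul_add] at hGF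
  refine (Ideal.add_mem_iff_left _ (Ideal.mem_sup_right ?_)).mp hGF
  exact Ideal.mem_span_singleton.mpr ⟨G * W, by ring⟩

lemma VanishesOnCurve.mem (hu : u ≠ 0) (hQ : Q ∈ homVanishingIdeal u)
    {F : MvPolynomial (Fin 3) K} {m : ℕ} (hm : m ≠ 0) (h : VanishesOnCurve Q u m F) :
    F ∈ homVanishingIdeal u := by
  obtain ⟨G, hG, hGF⟩ := h
  have hle : homVanishingIdeal u ^ m ⊔ Ideal.span {Q} ≤ homVanishingIdeal u :=
    sup_le (Ideal.pow_le_self hm) ((Ideal.span_singleton_le_iff_mem _).mpr hQ)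
  exact ((homVanishingIdeal_isPrime hu).mem_or_mem (hle hGF)).resolve_left hG

lemma VanishesOnCurve.of_mul_left (hu : u ≠ 0) (hL : L ∉ homVanishingIdeal u)
    {F : MvPolynomial (Fin 3) K} {m : ℕ} (h : VanishesOnCurve Q u m (L * F)) :
    VanishesOnCurve Q u m F := by
  obtain ⟨G, hG, hGF⟩ := h
  exact ⟨G * L, (homVanishingIdeal_isPrime hu).mul_notMem hG hL, by rwa [mul_assoc]⟩

lemma IsSecant.vanishesOnCurve_of_mul (hL : IsSecant Q u v L) (hu : u ≠ 0)
    {F : MvPolynomial (Fin 3) K} {m : ℕ} (h : VanishesOnCurve Q u (m + 1) (L * F)) :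
    VanishesOnCurve Q u m F := by
  obtain ⟨G, hG, hGF⟩ := h
  obtain ⟨T, hT, hTI⟩ := hL.left_local
  have hpow (k : ℕ) : ∀ F ∈ homVanishingIdeal u ^ k, T ^ k * F ∈ Ideal.span {L ^ k, Q} := by
    induction k with
    | zero => simp [Ideal.span_insert]
    | succ k ih =>
      intro F hF
      rw [pow_succ] at hF
      refine Submodule.mul_induction_on hF (fun a ha b hb => ?_) fun a b ha hb => ?_
      · obtain ⟨x, y, hxy⟩ := Ideal.mem_span_pair.mp (ih a ha)
        obtain ⟨x', y', hxy'⟩ := Ideal.mem_span_pair.mp (hTI b hb)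
        refine Ideal.mem_span_pair.mpr
          ⟨x * x', x * L ^ k * y' + y * x' * L + y * y' * Q, ?_⟩
        rw [show T ^ (k + 1) * (a * b) = (T ^ k * a) * (T * b) by ring, ← hxy, ← hxy']
        ring
      · rw [mul_add]
        exact add_mem ha hb
  obtain ⟨a, ha, w, hw, haw⟩ := Submodule.mem_sup.mp hGF
  obtain ⟨W, rfl⟩ := Ideal.mem_span_singleton.mp hw
  obtain ⟨x, y, hxy⟩ := Ideal.mem_span_pair.mp (hpow _ a ha)
  obtain ⟨Z, hZ⟩ := hL.dvd_of_dvd_mul (T ^ (m + 1) * G * F - x * L ^ m)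
    ⟨y + T ^ (m + 1) * W, by linear_combination (-T ^ (m + 1)) * haw - hxy⟩
  have hprime := homVanishingIdeal_isPrime hu
  refine ⟨T ^ (m + 1) * G,
    hprime.mul_notMem (fun h => hT (hprime.mem_of_pow_mem _ h)) hG, ?_⟩
  rw [sub_eq_iff_eq_add.mp hZ, add_comm]
  exact add_mem
    (Ideal.mem_sup_left (Ideal.mul_mem_left _ _ (Ideal.pow_mem_pow hL.mem_left m)))
    (Ideal.mem_sup_right (Ideal.mem_span_singleton.mpr ⟨Z, rfl⟩))

end VanishingOrder

section Polygon

variable {K ι : Type*} [Field K] [DecidableEq ι] {Q : MvPolynomial (Fin 3) K}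
  {P : ι → Fin 3 → K} {σ : Equiv.Perm ι} {L : ι → MvPolynomial (Fin 3) K}

/-- The number of endpoints of the edges `{k, σ k}`, `k ∈ s`, that are equal to `i`. -/
def edgeDegree (σ : Equiv.Perm ι) (s : Finset ι) (i : ι) : ℕ :=
  ∑ k ∈ s, ((if k = i then 1 else 0) + if σ k = i then 1 else 0)

lemma edgeDegree_univ [Fintype ι] (σ : Equiv.Perm ι) (i : ι) :
    edgeDegree σ Finset.univ i = 2 := by
  simp only [edgeDegree, Finset.sum_add_distrib, ← Equiv.eq_symm_apply, Finset.sum_ite_eq',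
    Finset.mem_univ, if_true]

lemma prod_mem_pow_edgeDegree (hσ : ∀ k, σ k ≠ k)
    (hL : ∀ k, IsSecant Q (P k) (P (σ k)) (L k)) (s : Finset ι) (i : ι) :
    ∏ k ∈ s, L k ∈ homVanishingIdeal (P i) ^ edgeDegree σ s i := by
  rw [edgeDegree, ← Finset.prod_pow_eq_pow_sum]
  refine Ideal.prod_mem_prod fun k _ => ?_
  by_cases hki : k = i
  · subst hki
    simpa [hσ k] using (hL k).mem_left
  by_cases hσi : σ k = i
  · subst hσi
    simpa [hki] using (hL k).mem_right
  · simp [hki, hσi]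

lemma exists_eq_prod_mul_add (hP : ProjectivelyDistinct P) (hσ : ∀ k, σ k ≠ k)
    (hQ : ∀ i, Q ∈ homVanishingIdeal (P i))
    (hL : ∀ k, IsSecant Q (P k) (P (σ k)) (L k)) (s : Finset ι) :
    ∀ (m : ι → ℕ) (F : MvPolynomial (Fin 3) K),
      (∀ i, VanishesOnCurve Q (P i) (m i + edgeDegree σ s i) F) →
      ∃ H W, F = (∏ k ∈ s, L k) * H + Q * W ∧ ∀ i, VanishesOnCurve Q (P i) (m i) H := by
  induction s using Finset.induction_on with
  | empty => exact fun m F hF => ⟨F, 0, by simp, by simpa [edgeDegree] using hF⟩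
  | insert k s hk ih =>
    intro m F hF
    obtain ⟨H, W, rfl, hH⟩ := ih
      (fun i => m i + ((if k = i then 1 else 0) + if σ k = i then 1 else 0)) F fun i => by
        simpa only [edgeDegree, Finset.sum_insert hk, add_assoc] using hF i
    have hHk : H ∈ homVanishingIdeal (P k) := (hH k).mem (hP.1 k) (hQ k) (by simp)
    have hHσ : H ∈ homVanishingIdeal (P (σ k)) := (hH (σ k)).mem (hP.1 _) (hQ _) (by simp)
    obtain ⟨x, y, rfl⟩ := Ideal.mem_span_pair.mp ((hL k).inf_le ⟨hHk, hHσ⟩)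
    refine ⟨x, (∏ k ∈ s, L k) * y + W, by rw [Finset.prod_insert hk]; ring, fun i => ?_⟩
    have hi := hH i
    rw [mul_comm x, mul_comm y] at hi
    have hi := hi.of_add_mul
    by_cases hki : k = i
    · subst hki
      rw [if_pos rfl, if_neg (hσ k), add_zero] at hi
      exact (hL k).vanishesOnCurve_of_mul (hP.1 k) hi
    by_cases hσi : σ k = i
    · subst hσi
      rw [if_pos rfl, if_neg hki, zero_add] at hi
      exact (hL k).symm.vanishesOnCurve_of_mul (hP.1 _) hi
    · rw [if_neg hki, if_neg hσi, add_zero, add_zero] at hi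
      have hQi := eval_eq_zero_of_mem_homVanishingIdeal (hQ i)
      exact hi.of_mul_left (hP.1 i)
        ((hL k).notMem _ hQi (hP.2 (Ne.symm hki)) (hP.2 (Ne.symm hσi)))

variable [Fintype ι]

lemma exists_eq_prod_pow_mul_add (hP : ProjectivelyDistinct P) (hσ : ∀ k, σ k ≠ k)
    (hQ : ∀ i, Q ∈ homVanishingIdeal (P i))
    (hL : ∀ k, IsSecant Q (P k) (P (σ k)) (L k)) (m j : ℕ) :
    ∀ F : MvPolynomial (Fin 3) K, (∀ i, VanishesOnCurve Q (P i) (m + 2 * j) F) →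
      ∃ H W, F = (∏ k, L k) ^ j * H + Q * W ∧ ∀ i, VanishesOnCurve Q (P i) m H := by
  induction j with
  | zero => exact fun F hF => ⟨F, 0, by simp, hF⟩
  | succ j ih =>
    intro F hF
    obtain ⟨H, W, rfl, hH⟩ := exists_eq_prod_mul_add hP hσ hQ hL Finset.univ
      (fun _ => m + 2 * j) F fun i => by rw [edgeDegree_univ]; exact hF i
    obtain ⟨H', W', rfl, hH'⟩ := ih H hH
    exact ⟨H', (∏ k, L k) * W' + W, by ring, hH'⟩

lemma prod_mem_irrel_mul_symbPow [Nonempty ι] (hσ : ∀ k, σ k ≠ k)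
    (hL : ∀ k, IsSecant Q (P k) (P (σ k)) (L k)) :
    ∏ k, L k ∈ irrel K (Fin 3) * symbPow P 1 := by
  obtain ⟨k⟩ := ‹Nonempty ι›
  rw [← Finset.mul_prod_erase _ _ (Finset.mem_univ k)]
  refine Ideal.mul_mem_mul (hL k).mem_irrel (Submodule.mem_iInf _ |>.mpr fun i => ?_)
  refine Ideal.pow_le_pow_right ?_ (prod_mem_pow_edgeDegree hσ hL (Finset.univ.erase k) i)
  have h := edgeDegree_univ σ i
  rw [edgeDegree, ← Finset.add_sum_erase _ _ (Finset.mem_univ k)] at h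
  have hk : ((if k = i then 1 else 0) + if σ k = i then 1 else 0) ≤ 1 := by
    have := hσ k
    split_ifs <;> simp_all
  rw [edgeDegree]
  omega

theorem symbPow_two_mul_le [Nonempty ι] (hP : ProjectivelyDistinct P) (hσ : ∀ k, σ k ≠ k)
    (hQM : Q ∈ irrel K (Fin 3)) (hQ : ∀ i, Q ∈ homVanishingIdeal (P i))
    (hQ2 : ∀ i, Q ∉ homVanishingIdeal (P i) ^ 2)
    (hL : ∀ k, IsSecant Q (P k) (P (σ k)) (L k)) (r : ℕ) :
    symbPow P (2 * r) ≤ (irrel K (Fin 3) * symbPow P 1) ^ r := by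
  have hD := prod_mem_irrel_mul_symbPow hσ hL
  have hQS : Q ∈ symbPow P 1 := (Submodule.mem_iInf _).mpr fun i => by simpa using hQ i
  have hDpow (j : ℕ) (i : ι) : (∏ k, L k) ^ j ∈ homVanishingIdeal (P i) ^ (2 * j) := by
    have := prod_mem_pow_edgeDegree hσ hL Finset.univ i
    rw [edgeDegree_univ] at this
    rw [pow_mul]
    exact Ideal.pow_mem_pow this j
  induction r with
  | zero => simp
  | succ j ih =>
    intro F hF
    have hF (i) : F ∈ homVanishingIdeal (P i) ^ (2 * j + 1 + 1) :=
      (Submodule.mem_iInf _).mp hF i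
    obtain ⟨H, W, rfl, -⟩ := exists_eq_prod_pow_mul_add hP hσ hQ hL 0 (j + 1) F
      fun i => .of_mem_pow (by simpa [mul_add] using hF i)
    have hW (i) : W ∈ homVanishingIdeal (P i) ^ (2 * j + 1) :=
      mem_homVanishingIdeal_pow_of_mul_mem (hP.1 i) (hQ2 i)
        ((Ideal.add_mem_iff_right _ (Ideal.mul_mem_right _ _ (hDpow (j + 1) i))).mp (hF i))
    obtain ⟨H', W', rfl, hH'⟩ := exists_eq_prod_pow_mul_add hP hσ hQ hL 1 j W
      fun i => .of_mem_pow (by rw [add_comm]; exact hW i)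
    have hH'I (i) : H' ∈ homVanishingIdeal (P i) := (hH' i).mem (hP.1 i) (hQ i) one_ne_zero
    have hH'S : H' ∈ symbPow P 1 := (Submodule.mem_iInf _).mpr fun i => by simpa using hH'I i
    have hW' : W' ∈ symbPow P (2 * j) := (Submodule.mem_iInf _).mpr fun i =>
      mem_homVanishingIdeal_pow_of_mul_mem (hP.1 i) (hQ2 i)
        ((Ideal.add_mem_iff_right _ (by
          rw [pow_succ]
          exact Ideal.mul_mem_mul (hDpow j i) (hH'I i))).mp (hW i))
    have hsplit : (∏ k, L k) ^ (j + 1) * H + Q * ((∏ k, L k) ^ j * H' + Q * W') =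
        (∏ k, L k) ^ (j + 1) * H + (∏ k, L k) ^ j * (Q * H') + W' * (Q * Q) := by ring
    rw [hsplit]
    refine add_mem (add_mem (Ideal.mul_mem_right _ _ (Ideal.pow_mem_pow hD _)) ?_) ?_ <;>
      rw [pow_succ]
    · exact Ideal.mul_mem_mul (Ideal.pow_mem_pow hD j) (Ideal.mul_mem_mul hQM hH'S)
    · exact Ideal.mul_mem_mul (ih hW') (Ideal.mul_mem_mul hQM hQS)

end Polygon

/-- For the radical ideal of an odd number `n ≥ 5` of distinct points on a
smooth plane conic, `I^{(2r)} ⊆ M^r I^r` for every `r ≥ 1`. -/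
theorem stmt8 {K : Type*} [Field K] [IsAlgClosed K]
    {n : ℕ} (hn : 5 ≤ n) (hodd : Odd n)
    (Q : MvPolynomial (Fin 3) K) (hQdeg : Q.IsHomogeneous 2) (hQ0 : Q ≠ 0)
    (hsm : ∀ p : Fin 3 → K, p ≠ 0 → MvPolynomial.eval p Q = 0 →
      ∃ i, MvPolynomial.eval p (MvPolynomial.pderiv i Q) ≠ 0)
    (P : Fin n → (Fin 3 → K)) (hP : ProjectivelyDistinct P)
    (honC : ∀ i, MvPolynomial.eval (P i) Q = 0)
    (r : ℕ) (hr : 1 ≤ r) :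
    symbPow P (2 * r) ≤ irrel K (Fin 3) ^ r * symbPow P 1 ^ r := by
  obtain ⟨m, rfl⟩ : ∃ m, n = m + 1 + 1 := ⟨n - 2, by omega⟩
  have hσ (k : Fin (m + 1 + 1)) : finRotate _ k ≠ k := by simp
  have hQ (i) : Q ∈ homVanishingIdeal (P i) :=
    mem_homVanishingIdeal_of_isHomogeneous hQdeg (honC i)
  have hQ2 (i) : Q ∉ homVanishingIdeal (P i) ^ 2 := fun h => by
    obtain ⟨k, hk⟩ := hsm _ (hP.1 i) (honC i)
    exact hk (eval_eq_zero_of_mem_homVanishingIdeal (pderiv_mem_of_mem_sq h k))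
  choose L hL using fun k => exists_isSecant hQdeg hsm (hP.1 k) (hP.2 (hσ k)) (honC k) (honC _)
  rw [← mul_pow]
  exact symbPow_two_mul_le hP hσ (mem_irrel_of_isHomogeneous hQdeg two_ne_zero) hQ hQ2 hL r
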